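/- arXiv:2503.03357 — 3 statements merged into one kernel-verified Lean document; each statement's English description precedes it below -/
import Mathlib

section
/- Let n ∈ ℕ and L, C, R ∈ ℝ_max^{n×n}. The system (8) is weakly consistent if and only if, for all k ∈ ℕ, every entry of Π_k lies in ℝ_max (i.e., no entry of Π_k equals +∞). -/
noncomputable section

open scoped Classical

/-- Max-plus matrix-vector product: `(A ⊗ x)_i = sup_j (A_{ij} + x_j)`. -/
def mpMulVec {N P : Type*} (A : N → P → EReal) (x : P → EReal) : N → EReal :=
  fun i => ⨆ j, A i j + x j

/-- Max-plus matrix-matrix product. -/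
def mpMulMat {N P Q : Type*} (A : N → P → EReal) (B : P → Q → EReal) : N → Q → EReal :=
  fun i j => ⨆ k, A i k + B k j

/-- Max-plus identity matrix `E`. -/
def mpId {N : Type*} [DecidableEq N] : N → N → EReal :=
  fun i j => if i = j then (0 : EReal) else ⊥

/-- Max-plus matrix powers: `A^0 = E`, `A^{k+1} = A^k ⊗ A`. -/
def mpPow {N : Type*} [DecidableEq N] (A : N → N → EReal) : ℕ → N → N → EReal
  | 0 => mpId
  | k + 1 => mpMulMat (mpPow A k) A

/-- Kleene star `A* = sup_{k ≥ 0} A^k` (entrywise supremum). -/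
def mpStar {N : Type*} [DecidableEq N] (A : N → N → EReal) : N → N → EReal :=
  fun i j => ⨆ k : ℕ, mpPow A k i j

/-- Image of a matrix: `Im U = { U ⊗ u : u ∈ ℝ_max^P } ⊆ ℝ_max^N`. -/
def mpIm {N P : Type*} (U : N → P → EReal) : Set (N → EReal) :=
  { x | (∀ i, x i ≠ ⊤) ∧ ∃ u : P → EReal, (∀ j, u j ≠ ⊤) ∧ x = mpMulVec U u }

/-- Existence of a positive-weight circuit in the precedence graph `G(A)`. -/
def hasPosCircuit {N : Type*} (A : N → N → EReal) : Prop :=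
  ∃ (l : ℕ) (p : ℕ → N), p l = p 0 ∧ (∀ t < l, A (p (t + 1)) (p t) ≠ ⊥) ∧
    0 < ∑ t ∈ Finset.range l, A (p (t + 1)) (p t)

/-- The block-tridiagonal matrix `M_[K]` with diagonal blocks `C`,
superdiagonal blocks `L`, subdiagonal blocks `R`. -/
def MK {n : ℕ} (L C R : Fin n → Fin n → EReal) (K : ℕ) :
    Fin K × Fin n → Fin K × Fin n → EReal :=
  fun p q =>
    if p.1.val = q.1.val then C p.2 q.2
    else if p.1.val + 1 = q.1.val then L p.2 q.2
    else if q.1.val + 1 = p.1.val then R p.2 q.2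
    else ⊥

/-- The infinite block-tridiagonal matrix `M_[∞]`, indexed by `ℕ × Fin n`. -/
def Minf {n : ℕ} (L C R : Fin n → Fin n → EReal) :
    ℕ × Fin n → ℕ × Fin n → EReal :=
  fun p q =>
    if p.1 = q.1 then C p.2 q.2
    else if p.1 + 1 = q.1 then L p.2 q.2
    else if q.1 + 1 = p.1 then R p.2 q.2
    else ⊥

/-- Existence of a finite real trajectory `x : {1,…,K} → ℝ^n` satisfying
`x(k) ≥ C ⊗ x(k)`, `x(k) ≥ L ⊗ x(k+1)` and `x(k+1) ≥ R ⊗ x(k)`. -/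
def FiniteTraj {n : ℕ} (L C R : Fin n → Fin n → EReal) (K : ℕ) : Prop :=
  ∃ x : Fin K → Fin n → ℝ,
    (∀ k : Fin K, ∀ i, mpMulVec C (fun j => (x k j : EReal)) i ≤ (x k i : EReal)) ∧
    (∀ k : Fin K, ∀ h : k.val + 1 < K, ∀ i,
      mpMulVec L (fun j => (x ⟨k.val + 1, h⟩ j : EReal)) i ≤ (x k i : EReal) ∧
      mpMulVec R (fun j => (x k j : EReal)) i ≤ (x ⟨k.val + 1, h⟩ i : EReal))

/-- Weak consistency of system (8). -/
def WeaklyConsistent {n : ℕ} (L C R : Fin n → Fin n → EReal) : Prop :=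
  ∀ K : ℕ, FiniteTraj L C R K

/-- Consistency of system (8): existence of an infinite real trajectory. -/
def Consistent {n : ℕ} (L C R : Fin n → Fin n → EReal) : Prop :=
  ∃ x : ℕ → Fin n → ℝ, ∀ k : ℕ,
    (∀ i, mpMulVec L (fun j => (x (k + 1) j : EReal)) i ≤ (x k i : EReal)) ∧
    (∀ i, mpMulVec C (fun j => (x k j : EReal)) i ≤ (x k i : EReal)) ∧
    (∀ i, mpMulVec R (fun j => (x k j : EReal)) i ≤ (x (k + 1) i : EReal))

/-- The sequence `Π_0 = C*`, `Π_{k+1} = (L ⊗ Π_k ⊗ R ⊕ C)*`. -/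
def PiSeq {n : ℕ} (L C R : Fin n → Fin n → EReal) : ℕ → Fin n → Fin n → EReal
  | 0 => mpStar C
  | k + 1 => mpStar (fun i j => max (mpMulMat (mpMulMat L (PiSeq L C R k)) R i j) (C i j))

/-- Lifted matrix `Ā = [[ε, E], [ε, ε]]`. -/
def Abar (n : ℕ) : Fin n ⊕ Fin n → Fin n ⊕ Fin n → EReal :=
  fun p q =>
    match p, q with
    | Sum.inl i, Sum.inr j => mpId i j
    | _, _ => ⊥

/-- Lifted matrix `B̄ = [ε; E]`. -/
def Bbar (n : ℕ) : Fin n ⊕ Fin n → Fin n → EReal :=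
  fun p j =>
    match p with
    | Sum.inl _ => ⊥
    | Sum.inr i => mpId i j

/-- Lifted matrix `H = [[C, L], [R, C]]`. -/
def Hmat {n : ℕ} (L C R : Fin n → Fin n → EReal) :
    Fin n ⊕ Fin n → Fin n ⊕ Fin n → EReal :=
  fun p q =>
    match p, q with
    | Sum.inl i, Sum.inl j => C i j
    | Sum.inl i, Sum.inr j => L i j
    | Sum.inr i, Sum.inl j => R i j
    | Sum.inr i, Sum.inr j => C i j

/-- The semimodule `K = Im H*`. -/
def Kset {n : ℕ} (L C R : Fin n → Fin n → EReal) : Set (Fin n ⊕ Fin n → EReal) :=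
  mpIm (mpStar (Hmat L C R))

/-- The map `φ(X) = X ∩ { x ∈ ℝ_max^N : ∃ u ∈ ℝ_max^M, A ⊗ x ⊕ B ⊗ u ∈ X }`. -/
def mpPhi {N M : Type*} (A : N → N → EReal) (B : N → M → EReal)
    (X : Set (N → EReal)) : Set (N → EReal) :=
  X ∩ { x | (∀ i, x i ≠ ⊤) ∧ ∃ u : M → EReal, (∀ j, u j ≠ ⊤) ∧
    (fun i => max (mpMulVec A x i) (mpMulVec B u i)) ∈ X }

/-- Controlled trajectory: `x(1) = x0`, `x(k+1) = A ⊗ x(k) ⊕ B ⊗ u(k)`. -/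
def mpTraj {N M : Type*} (A : N → N → EReal) (B : N → M → EReal)
    (x0 : N → EReal) (u : ℕ → M → EReal) : ℕ → N → EReal
  | 0 => x0
  | k + 1 => fun i => max (mpMulVec A (mpTraj A B x0 u k) i) (mpMulVec B (u k) i)

/-- `K^♯`: states of `K` from which some control keeps the whole trajectory in `K`. -/
def mpKsharp {N M : Type*} (A : N → N → EReal) (B : N → M → EReal)
    (K : Set (N → EReal)) : Set (N → EReal) :=
  { x | x ∈ K ∧ ∃ u : ℕ → M → EReal, (∀ k j, u k j ≠ ⊤) ∧
    ∀ k : ℕ, mpTraj A B x u k ∈ K }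

/-- Real vectors `ℝ^N` inside `ℝ̄^N`. -/
def RealVecs {N : Type*} : Set (N → EReal) := { x | ∀ i, x i ≠ ⊤ ∧ x i ≠ ⊥ }

/-- Semimodules of `ℝ_max^N`: closed under entrywise max and scalar addition. -/
def IsSemimodule {N : Type*} (X : Set (N → EReal)) : Prop :=
  (∀ x ∈ X, ∀ i, x i ≠ ⊤) ∧
  (∀ x ∈ X, ∀ y ∈ X, (fun i => max (x i) (y i)) ∈ X) ∧
  (∀ x ∈ X, ∀ lam : EReal, lam ≠ ⊤ → (fun i => lam + x i) ∈ X)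

/-- Embedding of the first two block indices into `Fin (k+2) × Fin n`. -/
def emb2 {n : ℕ} (k : ℕ) : Fin n ⊕ Fin n → Fin (k + 2) × Fin n
  | Sum.inl i => (⟨0, by omega⟩, i)
  | Sum.inr i => (⟨1, by omega⟩, i)

/-- `S_{k+2}`: top-left `2n × 2n` submatrix of `(M_[k+2])*`. -/
def Smat {n : ℕ} (L C R : Fin n → Fin n → EReal) (k : ℕ) :
    Fin n ⊕ Fin n → Fin n ⊕ Fin n → EReal :=
  fun p q => mpStar (MK L C R (k + 2)) (emb2 k p) (emb2 k q)

/-- Embedding of the first two block indices into `ℕ × Fin n`. -/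
def embInf {n : ℕ} : Fin n ⊕ Fin n → ℕ × Fin n
  | Sum.inl i => (0, i)
  | Sum.inr i => (1, i)

/-- `S_∞`: top-left `2n × 2n` submatrix of `(M_[∞])*`. -/
def Sinf {n : ℕ} (L C R : Fin n → Fin n → EReal) :
    Fin n ⊕ Fin n → Fin n ⊕ Fin n → EReal :=
  fun p q => mpStar (Minf L C R) (embInf p) (embInf q)

theorem EReal.add_coe_le_coe_iff {a : EReal} {x y : ℝ} :
    a + (y : EReal) ≤ (x : EReal) ↔ a ≤ ((x - y : ℝ) : EReal) := by
  rw [EReal.coe_sub, EReal.le_sub_iff_add_le (Or.inl (EReal.coe_ne_bot y))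
    (Or.inl (EReal.coe_ne_top y))]

theorem mpMulMat_le {N P Q : Type*} {A : N → P → EReal} {B : P → Q → EReal}
    {x : N → ℝ} {y : P → ℝ} {z : Q → ℝ}
    (hA : ∀ i j, A i j ≤ ((x i - y j : ℝ) : EReal))
    (hB : ∀ i j, B i j ≤ ((y i - z j : ℝ) : EReal)) (i : N) (j : Q) :
    mpMulMat A B i j ≤ ((x i - z j : ℝ) : EReal) := by
  refine iSup_le fun k => (add_le_add (hA i k) (hB k j)).trans_eq ?_
  rw [← EReal.coe_add]
  congr 1
  ring

theorem mpStar_le {N : Type*} [DecidableEq N] {A : N → N → EReal} {x : N → ℝ}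
    (hA : ∀ i j, A i j ≤ ((x i - x j : ℝ) : EReal)) (i j : N) :
    mpStar A i j ≤ ((x i - x j : ℝ) : EReal) := by
  refine iSup_le fun k => ?_
  induction k generalizing i j with
  | zero =>
    unfold mpPow mpId
    split_ifs with h
    · simp [h]
    · exact bot_le
  | succ k ih => exact mpMulMat_le ih hA i j

theorem zero_le_mpStar_self {N : Type*} [DecidableEq N] (A : N → N → EReal) (i : N) :
    0 ≤ mpStar A i i := by
  refine le_iSup_of_le 0 ?_
  simp [mpPow, mpId]

theorem le_mpStar {N : Type*} [DecidableEq N] (A : N → N → EReal) (i j : N) :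
    A i j ≤ mpStar A i j := by
  refine le_iSup_of_le 1 (le_iSup_of_le i ?_)
  simp [mpPow, mpId]

theorem mpPow_add_le {N : Type*} [DecidableEq N] (A : N → N → EReal) (k l : ℕ) (i j m : N) :
    mpPow A k i j + mpPow A l j m ≤ mpPow A (k + l) i m := by
  induction l generalizing m with
  | zero =>
    by_cases h : j = m
    · simp [mpPow, mpId, h]
    · simp [mpPow, mpId, h]
  | succ l ih =>
    refine EReal.add_le_of_forall_lt fun a ha b hb => ?_
    obtain ⟨p, hp⟩ := lt_iSup_iff.1 hb
    calc a + b ≤ mpPow A k i j + (mpPow A l j p + A p m) := add_le_add ha.le hp.le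
      _ = (mpPow A k i j + mpPow A l j p) + A p m := (add_assoc _ _ _).symm
      _ ≤ mpPow A (k + l) i p + A p m := add_le_add (ih p) le_rfl
      _ ≤ mpPow A (k + (l + 1)) i m :=
        le_iSup (fun q => mpPow A (k + l) i q + A q m) p

theorem mpStar_add_le {N : Type*} [DecidableEq N] (A : N → N → EReal) (i j m : N) :
    mpStar A i j + mpStar A j m ≤ mpStar A i m := by
  refine EReal.add_le_of_forall_lt fun a ha b hb => ?_
  obtain ⟨k, hk⟩ := lt_iSup_iff.1 ha
  obtain ⟨l, hl⟩ := lt_iSup_iff.1 hb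
  exact ((add_le_add hk.le hl.le).trans (mpPow_add_le A k l i j m)).trans
    (le_iSup (fun q => mpPow A q i m) (k + l))

section PiSeq

variable {n : ℕ} {L C R : Fin n → Fin n → EReal}

theorem PiSeq_eq_mpStar (L C R : Fin n → Fin n → EReal) (k : ℕ) :
    ∃ A : Fin n → Fin n → EReal, PiSeq L C R k = mpStar A ∧ ∀ i j, C i j ≤ A i j := by
  cases k with
  | zero => exact ⟨C, rfl, fun _ _ => le_rfl⟩
  | succ k => exact ⟨_, rfl, fun _ _ => le_max_right _ _⟩

theorem le_PiSeq (L C R : Fin n → Fin n → EReal) (k : ℕ) (i j : Fin n) :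
    C i j ≤ PiSeq L C R k i j := by
  obtain ⟨A, hA, hCA⟩ := PiSeq_eq_mpStar L C R k
  rw [hA]
  exact (hCA i j).trans (le_mpStar A i j)

theorem zero_le_PiSeq_self (L C R : Fin n → Fin n → EReal) (k : ℕ) (i : Fin n) :
    0 ≤ PiSeq L C R k i i := by
  obtain ⟨A, hA, -⟩ := PiSeq_eq_mpStar L C R k
  rw [hA]
  exact zero_le_mpStar_self A i

theorem PiSeq_add_le (L C R : Fin n → Fin n → EReal) (k : ℕ) (i j m : Fin n) :
    PiSeq L C R k i j + PiSeq L C R k j m ≤ PiSeq L C R k i m := by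
  obtain ⟨A, hA, -⟩ := PiSeq_eq_mpStar L C R k
  rw [hA]
  exact mpStar_add_le A i j m

theorem add_PiSeq_add_le (L C R : Fin n → Fin n → EReal) (k : ℕ) (i b c j : Fin n) :
    L i b + PiSeq L C R k b c + R c j ≤ PiSeq L C R (k + 1) i j := by
  refine le_trans ?_ (le_mpStar _ i j)
  refine le_trans ?_ (le_max_left _ _)
  refine le_trans ?_ (le_iSup (fun q => mpMulMat L (PiSeq L C R k) i q + R q j) c)
  exact add_le_add (le_iSup (fun q => L i q + PiSeq L C R k q c) b) le_rfl

theorem PiSeq_le_of_trajectory (k : ℕ) (x : ℕ → Fin n → ℝ)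
    (hC : ∀ t ≤ k, ∀ i j, C i j ≤ ((x t i - x t j : ℝ) : EReal))
    (hL : ∀ t < k, ∀ i j, L i j ≤ ((x t i - x (t + 1) j : ℝ) : EReal))
    (hR : ∀ t < k, ∀ i j, R i j ≤ ((x (t + 1) i - x t j : ℝ) : EReal)) (i j : Fin n) :
    PiSeq L C R k i j ≤ ((x 0 i - x 0 j : ℝ) : EReal) := by
  induction k generalizing x i j with
  | zero => exact mpStar_le (hC 0 le_rfl) i j
  | succ k ih =>
    refine mpStar_le (fun a b => max_le ?_ (hC 0 (Nat.zero_le _) a b)) i j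
    refine mpMulMat_le (mpMulMat_le (hL 0 k.succ_pos) ?_) (hR 0 k.succ_pos) a b
    exact ih (fun t => x (t + 1)) (fun t ht => hC (t + 1) (by omega))
      (fun t ht => hL (t + 1) (by omega)) (fun t ht => hR (t + 1) (by omega))

/-- If no entry of `Π_k` is `+∞`, then `Π_k ⊗ v` is real for every real `v`, and it is
subinvariant under `Π_k`. -/
theorem exists_real_PiSeq_mulVec {k : ℕ} (hk : ∀ i j, PiSeq L C R k i j ≠ ⊤)
    (v : Fin n → ℝ) :
    ∃ y : Fin n → ℝ, (∀ a, v a ≤ y a) ∧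
      (∀ a b, PiSeq L C R k a b + (y b : EReal) ≤ (y a : EReal)) ∧
      ∀ a, ∃ b, (y a : EReal) = PiSeq L C R k a b + (v b : EReal) := by
  set X := mpMulVec (PiSeq L C R k) (fun j => (v j : EReal))
  have hatt : ∀ a, ∃ b, PiSeq L C R k a b + (v b : EReal) = X a := fun a =>
    haveI : Nonempty (Fin n) := ⟨a⟩
    exists_eq_ciSup_of_finite (f := fun b => PiSeq L C R k a b + (v b : EReal))
  have hle : ∀ a b, PiSeq L C R k a b + (v b : EReal) ≤ X a := fun a b =>
    le_iSup (fun b => PiSeq L C R k a b + (v b : EReal)) b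
  have hv : ∀ a, (v a : EReal) ≤ X a := fun a =>
    le_trans (by simpa using add_le_add (zero_le_PiSeq_self L C R k a) (le_refl (v a : EReal)))
      (hle a a)
  have htop : ∀ a, X a ≠ ⊤ := by
    intro a
    obtain ⟨b, hb⟩ := hatt a
    rw [← hb]
    exact EReal.add_ne_top (hk a b) (EReal.coe_ne_top _)
  have hcoe : ∀ a, ((X a).toReal : EReal) = X a := fun a =>
    EReal.coe_toReal (htop a) (ne_bot_of_le_ne_bot (EReal.coe_ne_bot _) (hv a))
  refine ⟨fun a => (X a).toReal, fun a => ?_, fun a b => ?_, fun a => ?_⟩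
  · rw [← EReal.coe_le_coe_iff, hcoe]
    exact hv a
  · rw [hcoe, hcoe]
    obtain ⟨c, hc⟩ := hatt b
    rw [← hc, ← add_assoc]
    exact (add_le_add (PiSeq_add_le L C R k a b c) le_rfl).trans (hle a c)
  · obtain ⟨b, hb⟩ := hatt a
    exact ⟨b, by rw [hcoe, hb]⟩

theorem exists_next_state (hL : ∀ i j, L i j ≠ ⊤) (hR : ∀ i j, R i j ≠ ⊤) {k : ℕ}
    (hk : ∀ i j, PiSeq L C R k i j ≠ ⊤) (x : Fin n → ℝ)
    (hx : ∀ i j, PiSeq L C R (k + 1) i j + (x j : EReal) ≤ (x i : EReal)) :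
    ∃ y : Fin n → ℝ, (∀ i j, PiSeq L C R k i j + (y j : EReal) ≤ (y i : EReal)) ∧
      (∀ i j, L i j + (y j : EReal) ≤ (x i : EReal)) ∧
      ∀ i j, R i j + (x j : EReal) ≤ (y i : EReal) := by
  obtain ⟨M, hM⟩ := (Set.finite_range fun p : Fin n × Fin n × Fin n =>
    (L p.1 p.2.1 + PiSeq L C R k p.2.1 p.2.2).toReal - x p.1).bddAbove
  have hM' : ∀ i b c, L i b + (PiSeq L C R k b c + ((-M : ℝ) : EReal)) ≤ (x i : EReal) := by
    intro i b c
    rw [← add_assoc, EReal.add_coe_le_coe_iff]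
    refine (EReal.le_coe_toReal (EReal.add_ne_top (hL i b) (hk b c))).trans ?_
    rw [EReal.coe_le_coe_iff]
    have : (L i b + PiSeq L C R k b c).toReal - x i ≤ M :=
      hM (Set.mem_range_self (i, b, c))
    linarith
  set V : Fin n → EReal := fun c =>
    max (mpMulVec R (fun j => (x j : EReal)) c) ((-M : ℝ) : EReal) with hV
  have hatt : ∀ c, ∃ j, R c j + (x j : EReal) = mpMulVec R (fun j => (x j : EReal)) c :=
    fun c =>
      haveI : Nonempty (Fin n) := ⟨c⟩
      exists_eq_ciSup_of_finite (f := fun j => R c j + (x j : EReal))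
  have hVcoe : ∀ c, ((V c).toReal : EReal) = V c := by
    intro c
    refine EReal.coe_toReal ?_ (ne_bot_of_le_ne_bot (EReal.coe_ne_bot _) (le_max_right _ _))
    obtain ⟨j, hj⟩ := hatt c
    rcases max_choice (mpMulVec R (fun j => (x j : EReal)) c) ((-M : ℝ) : EReal) with h | h
    · rw [hV]
      dsimp only
      rw [h, ← hj]
      exact EReal.add_ne_top (hR c j) (EReal.coe_ne_top _)
    · rw [hV]
      dsimp only
      rw [h]
      exact EReal.coe_ne_top _
  obtain ⟨y, hvy, hsub, hy⟩ := exists_real_PiSeq_mulVec hk (fun c => (V c).toReal)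
  refine ⟨y, hsub, fun i b => ?_, fun i j => ?_⟩
  · obtain ⟨c, hc⟩ := hy b
    rw [hc, hVcoe]
    rcases max_choice (mpMulVec R (fun j => (x j : EReal)) c) ((-M : ℝ) : EReal) with h | h
    · obtain ⟨j, hj⟩ := hatt c
      rw [hV]
      dsimp only
      rw [h, ← hj, ← add_assoc, ← add_assoc]
      exact (add_le_add (add_PiSeq_add_le L C R k i b c j) le_rfl).trans (hx i j)
    · rw [hV]
      dsimp only
      rw [h]
      exact hM' i b c
  · calc R i j + (x j : EReal) ≤ mpMulVec R (fun j => (x j : EReal)) i :=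
          le_iSup (fun j => R i j + (x j : EReal)) j
      _ ≤ V i := le_max_left _ _
      _ = ((V i).toReal : EReal) := (hVcoe i).symm
      _ ≤ (y i : EReal) := EReal.coe_le_coe_iff.2 (hvy i)

theorem exists_trajectory (hL : ∀ i j, L i j ≠ ⊤) (hR : ∀ i j, R i j ≠ ⊤)
    (hP : ∀ k i j, PiSeq L C R k i j ≠ ⊤) (k : ℕ) (x₀ : Fin n → ℝ)
    (hx₀ : ∀ i j, PiSeq L C R k i j + (x₀ j : EReal) ≤ (x₀ i : EReal)) :
    ∃ x : ℕ → Fin n → ℝ, x 0 = x₀ ∧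
      (∀ t ≤ k, ∀ i j, C i j + (x t j : EReal) ≤ (x t i : EReal)) ∧
      ∀ t < k, (∀ i j, L i j + (x (t + 1) j : EReal) ≤ (x t i : EReal)) ∧
        ∀ i j, R i j + (x t j : EReal) ≤ (x (t + 1) i : EReal) := by
  have hC₀ : ∀ i j, C i j + (x₀ j : EReal) ≤ (x₀ i : EReal) := fun i j =>
    (add_le_add (le_PiSeq L C R k i j) le_rfl).trans (hx₀ i j)
  induction k generalizing x₀ with
  | zero =>
    refine ⟨fun _ => x₀, rfl, fun _ _ => hC₀, fun t ht => absurd ht t.not_lt_zero⟩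
  | succ k ih =>
    obtain ⟨y, hy, hLy, hRy⟩ := exists_next_state hL hR (hP k) x₀ hx₀
    obtain ⟨z, hz₀, hzC, hz⟩ := ih y hy fun i j =>
      (add_le_add (le_PiSeq L C R k i j) le_rfl).trans (hy i j)
    refine ⟨fun t => Nat.casesOn t x₀ z, rfl, fun t ht => ?_, fun t ht => ?_⟩
    · cases t with
      | zero => exact hC₀
      | succ t => exact hzC t (by omega)
    · cases t with
      | zero =>
        subst hz₀
        exact ⟨hLy, hRy⟩
      | succ t => exact hz t (by omega)

end PiSeq

/-- system (8) is weakly consistent iff, for all `k ∈ ℕ`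
(positive integers), no entry of `Π_k` equals `+∞`. -/
theorem stmt_10 (n : ℕ) (hn : 0 < n) (L C R : Fin n → Fin n → EReal)
    (hL : ∀ i j, L i j ≠ ⊤) (hC : ∀ i j, C i j ≠ ⊤) (hR : ∀ i j, R i j ≠ ⊤) :
    WeaklyConsistent L C R ↔
      ∀ k : ℕ, 0 < k → ∀ i j, PiSeq L C R k i j ≠ ⊤ := by
  constructor
  · intro h k _ i j
    obtain ⟨x, hxC, hx⟩ := h (k + 1)
    set z : ℕ → Fin n → ℝ := fun t => if ht : t < k + 1 then x ⟨t, ht⟩ else 0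
    have hzx : ∀ t (ht : t < k + 1), z t = x ⟨t, ht⟩ := fun t ht => dif_pos ht
    refine ne_top_of_le_ne_top (EReal.coe_ne_top _)
      (PiSeq_le_of_trajectory k z (fun t ht a b => ?_) (fun t ht a b => ?_)
        (fun t ht a b => ?_) i j)
    · rw [← EReal.add_coe_le_coe_iff, hzx t (by omega)]
      exact iSup_le_iff.1 (hxC ⟨t, by omega⟩ a) b
    · rw [← EReal.add_coe_le_coe_iff, hzx t (by omega), hzx (t + 1) (by omega)]
      exact iSup_le_iff.1 (hx ⟨t, by omega⟩ (Nat.succ_lt_succ ht) a).1 b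
    · rw [← EReal.add_coe_le_coe_iff, hzx t (by omega), hzx (t + 1) (by omega)]
      exact iSup_le_iff.1 (hx ⟨t, by omega⟩ (Nat.succ_lt_succ ht) a).2 b
  · intro h K
    have hP : ∀ k i j, PiSeq L C R k i j ≠ ⊤ := by
      rintro (_ | k) i j
      · refine ne_top_of_le_ne_top (h 1 one_pos i j) (iSup_mono fun k => ?_)
        induction k generalizing i j with
        | zero => exact le_rfl
        | succ k ih =>
          exact iSup_mono fun p => add_le_add (ih i p) (le_max_right _ _)
      · exact h (k + 1) k.succ_pos i j
    obtain ⟨x₀, -, hx₀, -⟩ := exists_real_PiSeq_mulVec (hP K) 0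
    obtain ⟨x, -, hxC, hx⟩ := exists_trajectory hL hR hP K x₀ hx₀
    refine ⟨fun t => x t, fun t i => iSup_le (hxC t t.2.le i), fun t ht i => ⟨?_, ?_⟩⟩
    · exact iSup_le ((hx t t.2).1 i)
    · exact iSup_le ((hx t t.2).2 i)
end
end

section
/- (Katz's lemma.) Let A ∈ ℝ_max^{N×N}, B ∈ ℝ_max^{N×m} and let K ⊆ ℝ_max^N be a semimodule. Define K^♯ = { x ∈ K : ∃ u : ℕ → ℝ_max^m such that the trajectory x(1) = x, x(k+1) = A ⊗ x(k) ⊕ B ⊗ u(k) satisfies x(k) ∈ K for all k ∈ ℕ }. Then (i) K^♯ is a semimodule; (ii) K^♯ is (A,B)-invariant, i.e., for every x ∈ K^♯ there exists u ∈ ℝ_max^m with A ⊗ x ⊕ B ⊗ u ∈ K^♯; and (iii) every (A,B)-invariant subset X ⊆ K (i.e., every X ⊆ K such that for each x ∈ X there is u ∈ ℝ_max^m with A ⊗ x ⊕ B ⊗ u ∈ X) satisfies X ⊆ K^♯. Hence K^♯ is the maximal (A,B)-invariant subsemimodule of K. -/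
noncomputable section

open scoped Classical

theorem EReal.add_iSup_of_ne_top {ι : Type*} (f : ι → EReal) {c : EReal} (hc : c ≠ ⊤) :
    c + ⨆ j, f j = ⨆ j, c + f j := by
  induction c with
  | bot => simp
  | top => exact absurd rfl hc
  | coe r =>
    refine le_antisymm ?_ (iSup_le fun j => by gcongr; exact le_iSup f j)
    have hr : ((-r : ℝ) : EReal) + (r : EReal) = 0 := by
      rw [← EReal.coe_add, neg_add_cancel, EReal.coe_zero]
    have hr' : (r : EReal) + ((-r : ℝ) : EReal) = 0 := by rw [add_comm, hr]
    have h : ⨆ j, f j ≤ ((-r : ℝ) : EReal) + ⨆ j, ((r : EReal) + f j) := by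
      refine iSup_le fun j => ?_
      calc f j = ((-r : ℝ) : EReal) + ((r : EReal) + f j) := by
            rw [← add_assoc, hr, zero_add]
        _ ≤ _ := by gcongr; exact le_iSup (fun j => (r : EReal) + f j) j
    calc (r : EReal) + ⨆ j, f j
        ≤ (r : EReal) + (((-r : ℝ) : EReal) + ⨆ j, ((r : EReal) + f j)) := by gcongr
      _ = _ := by rw [← add_assoc, hr', zero_add]

theorem mpMulVec_max {N P : Type*} (A : N → P → EReal) (x y : P → EReal) :
    mpMulVec A (fun j => max (x j) (y j)) =
      fun i => max (mpMulVec A x i) (mpMulVec A y i) := by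
  funext i
  have h (a b c : EReal) : a + max b c = max (a + b) (a + c) :=
    Monotone.map_max fun _ _ hbc => add_le_add_right hbc a
  simp only [mpMulVec, h]
  exact iSup_sup_eq

theorem mpMulVec_add_left {N P : Type*} (A : N → P → EReal) (x : P → EReal)
    {c : EReal} (hc : c ≠ ⊤) :
    mpMulVec A (fun j => c + x j) = fun i => c + mpMulVec A x i := by
  funext i
  simp only [mpMulVec, EReal.add_iSup_of_ne_top _ hc, add_left_comm]

theorem mpTraj_max {N M : Type*} (A : N → N → EReal) (B : N → M → EReal)
    (x y : N → EReal) (u v : ℕ → M → EReal) (k : ℕ) :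
    mpTraj A B (fun i => max (x i) (y i)) (fun k j => max (u k j) (v k j)) k =
      fun i => max (mpTraj A B x u k i) (mpTraj A B y v k i) := by
  induction k with
  | zero => rfl
  | succ k ih =>
    simp only [mpTraj, ih, mpMulVec_max]
    funext i
    exact max_max_max_comm _ _ _ _

theorem mpTraj_add_left {N M : Type*} (A : N → N → EReal) (B : N → M → EReal)
    (x : N → EReal) (u : ℕ → M → EReal) {c : EReal} (hc : c ≠ ⊤) (k : ℕ) :
    mpTraj A B (fun i => c + x i) (fun k j => c + u k j) k =
      fun i => c + mpTraj A B x u k i := by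
  induction k with
  | zero => rfl
  | succ k ih =>
    simp only [mpTraj, ih, mpMulVec_add_left _ _ hc]
    funext i
    exact (Monotone.map_max fun _ _ hab => add_le_add_right hab c).symm

theorem mpTraj_tail {N M : Type*} (A : N → N → EReal) (B : N → M → EReal)
    (x : N → EReal) (u : ℕ → M → EReal) (k : ℕ) :
    mpTraj A B (mpTraj A B x u 1) (fun k => u (k + 1)) k = mpTraj A B x u (k + 1) := by
  induction k with
  | zero => rfl
  | succ k ih => simp only [mpTraj] at ih ⊢; rw [ih]

theorem isSemimodule_mpKsharp {N M : Type*} (A : N → N → EReal) (B : N → M → EReal)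
    {K : Set (N → EReal)} (hK : IsSemimodule K) : IsSemimodule (mpKsharp A B K) := by
  obtain ⟨htop, hmax, hadd⟩ := hK
  refine ⟨fun x hx => htop x hx.1, ?_, ?_⟩
  · rintro x ⟨hx, u, hu, hxu⟩ y ⟨hy, v, hv, hyv⟩
    refine ⟨hmax x hx y hy, fun k j => max (u k j) (v k j), fun k j => ?_, fun k => ?_⟩
    · exact (max_lt (hu k j).lt_top (hv k j).lt_top).ne
    · rw [mpTraj_max]
      exact hmax _ (hxu k) _ (hyv k)
  · rintro x ⟨hx, u, hu, hxu⟩ c hc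
    refine ⟨hadd x hx c hc, fun k j => c + u k j,
      fun k j => EReal.add_ne_top hc (hu k j), fun k => ?_⟩
    rw [mpTraj_add_left A B x u hc]
    exact hadd _ (hxu k) c hc

theorem exists_mem_mpKsharp_of_mem {N M : Type*} (A : N → N → EReal) (B : N → M → EReal)
    {K : Set (N → EReal)} {x : N → EReal} (hx : x ∈ mpKsharp A B K) :
    ∃ u : M → EReal, (∀ j, u j ≠ ⊤) ∧
      (fun i => max (mpMulVec A x i) (mpMulVec B u i)) ∈ mpKsharp A B K := by
  obtain ⟨-, u, hu, hxu⟩ := hx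
  refine ⟨u 0, hu 0, hxu 1, fun k => u (k + 1), fun k => hu (k + 1), fun k => ?_⟩
  have h := hxu (k + 1)
  rwa [← mpTraj_tail] at h

theorem subset_mpKsharp_of_invariant {N M : Type*} (A : N → N → EReal) (B : N → M → EReal)
    {K X : Set (N → EReal)} (hXK : X ⊆ K)
    (hX : ∀ x ∈ X, ∃ u : M → EReal, (∀ j, u j ≠ ⊤) ∧
      (fun i => max (mpMulVec A x i) (mpMulVec B u i)) ∈ X) :
    X ⊆ mpKsharp A B K := by
  intro x hx
  choose u hu hmem using hX
  let next (z : X) : X := ⟨_, hmem z z.2⟩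
  let traj (k : ℕ) : X := next^[k] ⟨x, hx⟩
  have htraj (k : ℕ) :
      mpTraj A B x (fun k => u (traj k) (traj k).2) k = (traj k : N → EReal) := by
    induction k with
    | zero => rfl
    | succ k ih =>
      have hs : traj (k + 1) = next (traj k) := Function.iterate_succ_apply' _ _ _
      rw [hs, mpTraj, ih]
  exact ⟨hXK hx, fun k => u (traj k) (traj k).2, fun k => hu _ _,
    fun k => by rw [htraj]; exact hXK (traj k).2⟩

/-- Katz's lemma: `K^♯` is a semimodule, it is
`(A,B)`-invariant, and every `(A,B)`-invariant subset of `K` is contained in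
`K^♯`; hence `K^♯` is the maximal `(A,B)`-invariant subsemimodule of `K`. -/
theorem stmt_15 (N M : Type*) (A : N → N → EReal) (B : N → M → EReal)
    (hA : ∀ i j, A i j ≠ ⊤) (hB : ∀ i j, B i j ≠ ⊤)
    (K : Set (N → EReal)) (hK : IsSemimodule K) :
    IsSemimodule (mpKsharp A B K) ∧
    (∀ x ∈ mpKsharp A B K, ∃ u : M → EReal, (∀ j, u j ≠ ⊤) ∧
      (fun i => max (mpMulVec A x i) (mpMulVec B u i)) ∈ mpKsharp A B K) ∧
    (∀ X : Set (N → EReal), X ⊆ K →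
      (∀ x ∈ X, ∃ u : M → EReal, (∀ j, u j ≠ ⊤) ∧
        (fun i => max (mpMulVec A x i) (mpMulVec B u i)) ∈ X) →
      X ⊆ mpKsharp A B K) := by
  exact ⟨isSemimodule_mpKsharp A B hK, fun _ => exists_mem_mpKsharp_of_mem A B,
    fun _ => subset_mpKsharp_of_invariant A B⟩
end
end

section
/- Let n ∈ ℕ and L, C, R ∈ ℝ_max^{n×n}, and consider the lifted system with matrices Ā, B̄, H and semimodule K = Im H*. Then the following two conditions together — (a) the sequence φ^k(K) ∩ ℝ^{2n} does not converge in finitely many steps, i.e., φ^{k+1}(K) ∩ ℝ^{2n} ≠ φ^k(K) ∩ ℝ^{2n} for all k ∈ ℕ₀, and (b) K^♯ ∩ ℝ^{2n} = ∅ — hold if and only if the system (8) is weakly consistent but not consistent. -/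
noncomputable section

open scoped Classical

/-- The inequalities of system (8) between two consecutive states `a` and `b`. -/
def IsStep {n : ℕ} (L C R : Fin n → Fin n → EReal) (a b : Fin n → EReal) : Prop :=
  ∀ i j, C i j + a j ≤ a i ∧ C i j + b j ≤ b i ∧ L i j + b j ≤ a i ∧ R i j + a j ≤ b i

theorem EReal.add_iSup_le_of_ne_top {ι : Sort*} {a c : EReal} {f : ι → EReal} (ha : a ≠ ⊤)
    (h : ∀ i, a + f i ≤ c) : a + ⨆ i, f i ≤ c := by
  induction a with
  | bot => simp
  | top => exact absurd rfl ha
  | coe a =>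
    have key (y : EReal) : (a : EReal) + y ≤ c ↔ y ≤ c - a := by
      rw [EReal.le_sub_iff_add_le (by simp) (by simp), add_comm]
    rw [key]
    exact iSup_le fun i => (key _).1 (h i)

theorem EReal.iSup_add_le_of_ne_top {ι : Sort*} {a c : EReal} {f : ι → EReal} (ha : a ≠ ⊤)
    (h : ∀ i, f i + a ≤ c) : (⨆ i, f i) + a ≤ c := by
  rw [add_comm]
  exact EReal.add_iSup_le_of_ne_top ha fun i => by rw [add_comm]; exact h i

section Star

variable {N : Type*} [DecidableEq N] {A : N → N → EReal}

theorem add_mpPow_le_mpPow_succ (hA : ∀ p q, A p q ≠ ⊤) (k : ℕ) (p q r : N) :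
    A p q + mpPow A k q r ≤ mpPow A (k + 1) p r := by
  induction k generalizing r with
  | zero =>
    by_cases h : q = r
    · subst h
      refine le_trans ?_ (le_iSup _ p)
      simp [mpPow, mpId]
    · simp [mpPow, mpId, h]
  | succ k ih =>
    refine EReal.add_iSup_le_of_ne_top (hA p q) fun s => ?_
    rw [← add_assoc]
    exact (add_le_add_left (ih s) _).trans (le_iSup (fun s => mpPow A (k + 1) p s + A s r) s)

theorem add_mpMulVec_mpStar_le (hA : ∀ p q, A p q ≠ ⊤) (u : N → EReal) (p q : N) :
    A p q + mpMulVec (mpStar A) u q ≤ mpMulVec (mpStar A) u p := by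
  refine EReal.add_iSup_le_of_ne_top (hA p q) fun r => ?_
  rw [← add_assoc]
  have h : A p q + mpStar A q r ≤ mpStar A p r :=
    EReal.add_iSup_le_of_ne_top (hA p q) fun k =>
      (add_mpPow_le_mpPow_succ hA k p q r).trans (le_iSup (fun k => mpPow A k p r) (k + 1))
  exact (add_le_add_left h _).trans (le_iSup (fun r => mpStar A p r + u r) r)

theorem mpPow_add_le_s18 {x : N → EReal} (hx : ∀ i, x i ≠ ⊤)
    (h : ∀ p q, A p q + x q ≤ x p) (k : ℕ) (p q : N) : mpPow A k p q + x q ≤ x p := by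
  induction k generalizing q with
  | zero =>
    by_cases hpq : p = q
    · simp [mpPow, mpId, hpq]
    · simp [mpPow, mpId, hpq]
  | succ k ih =>
    refine EReal.iSup_add_le_of_ne_top (hx q) fun s => ?_
    rw [add_assoc]
    exact (add_le_add_right (h s q) _).trans (ih s)

/-- `Im A*` is the set of the vectors of `ℝ_max^N` with `A ⊗ x ≤ x`. -/
theorem mem_mpIm_mpStar_iff (hA : ∀ p q, A p q ≠ ⊤) {x : N → EReal} :
    x ∈ mpIm (mpStar A) ↔ (∀ i, x i ≠ ⊤) ∧ ∀ p q, A p q + x q ≤ x p := by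
  constructor
  · rintro ⟨hx, u, -, rfl⟩
    exact ⟨hx, add_mpMulVec_mpStar_le hA u⟩
  · rintro ⟨hx, h⟩
    refine ⟨hx, x, hx, funext fun p => le_antisymm ?_ ?_⟩
    · refine le_trans ?_ (le_iSup _ p)
      have h0 : (0 : EReal) ≤ mpStar A p p :=
        le_trans (by simp [mpPow, mpId]) (le_iSup (fun k => mpPow A k p p) 0)
      simpa using add_le_add_left h0 (x p)
    · exact iSup_le fun q => EReal.iSup_add_le_of_ne_top (hx q) fun k => mpPow_add_le_s18 hx h k p q

end Star

section Lifted

variable {n : ℕ} {L C R : Fin n → Fin n → EReal}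

theorem mem_Kset_iff (hL : ∀ i j, L i j ≠ ⊤) (hC : ∀ i j, C i j ≠ ⊤) (hR : ∀ i j, R i j ≠ ⊤)
    {x : Fin n ⊕ Fin n → EReal} :
    x ∈ Kset L C R ↔
      (∀ i, x i ≠ ⊤) ∧ IsStep L C R (fun i => x (Sum.inl i)) (fun i => x (Sum.inr i)) := by
  rw [Kset, mem_mpIm_mpStar_iff (by rintro (i | i) (j | j) <;> simp [Hmat, hL, hC, hR])]
  refine and_congr_right fun _ => ⟨fun h i j => ?_, fun h => ?_⟩
  · exact ⟨h (Sum.inl i) (Sum.inl j), h (Sum.inr i) (Sum.inr j), h (Sum.inl i) (Sum.inr j),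
      h (Sum.inr i) (Sum.inl j)⟩
  · rintro (i | i) (j | j)
    exacts [(h i j).1, (h i j).2.2.1, (h i j).2.2.2, (h i j).2.1]

theorem mpMulVec_mpId {N : Type*} [DecidableEq N] (x : N → EReal) : mpMulVec mpId x = x := by
  funext i
  refine le_antisymm (iSup_le fun j => ?_) (le_trans ?_ (le_iSup _ i))
  · by_cases h : i = j <;> simp [mpId, h]
  · simp [mpId]

theorem mpMulVec_Abar_max_Bbar (x : Fin n ⊕ Fin n → EReal) (u : Fin n → EReal) :
    (fun i => max (mpMulVec (Abar n) x i) (mpMulVec (Bbar n) u i)) =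
      Sum.elim (fun i => x (Sum.inr i)) u := by
  funext p
  rcases p with i | i
  · have h := congrFun (mpMulVec_mpId fun i => x (Sum.inr i)) i
    simpa [mpMulVec, Abar, Bbar, iSup_sum] using h
  · have h := congrFun (mpMulVec_mpId u) i
    simpa [mpMulVec, Abar, Bbar, iSup_sum] using h

theorem mem_iterate_mpPhi_iff (hL : ∀ i j, L i j ≠ ⊤) (hC : ∀ i j, C i j ≠ ⊤)
    (hR : ∀ i j, R i j ≠ ⊤) (k : ℕ) (x : Fin n ⊕ Fin n → EReal) :
    x ∈ (mpPhi (Abar n) (Bbar n))^[k] (Kset L C R) ↔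
      ∃ z : ℕ → Fin n → EReal, (∀ t i, z t i ≠ ⊤) ∧ (∀ t ≤ k, IsStep L C R (z t) (z (t + 1))) ∧
        x = Sum.elim (z 0) (z 1) := by
  induction k generalizing x with
  | zero =>
    rw [Function.iterate_zero, id, mem_Kset_iff hL hC hR]
    constructor
    · rintro ⟨hx, h⟩
      refine ⟨fun t => if t = 0 then fun i => x (Sum.inl i) else fun i => x (Sum.inr i),
        fun t i => ?_, fun t ht => ?_, ?_⟩
      · by_cases ht : t = 0 <;> simp [ht, hx]
      · obtain rfl : t = 0 := by omega
        simpa using h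
      · funext p
        rcases p with i | i <;> simp
    · rintro ⟨z, hz, h, rfl⟩
      exact ⟨by rintro (i | i) <;> simp [hz], h 0 le_rfl⟩
  | succ k ih =>
    rw [Function.iterate_succ_apply']
    constructor
    · rintro ⟨hx, hx', u, -, hu⟩
      rw [mpMulVec_Abar_max_Bbar] at hu
      obtain ⟨z, hz, h, rfl⟩ := (ih x).1 hx
      obtain ⟨w, hw, h', e⟩ := (ih _).1 hu
      have e0 : w 0 = z 1 := funext fun i => (congrFun e (Sum.inl i)).symm
      refine ⟨fun t => Nat.casesOn t (z 0) w, fun t => ?_, fun t ht => ?_, ?_⟩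
      · cases t with
        | zero => exact hz 0
        | succ t => exact hw t
      · cases t with
        | zero => simpa [e0] using h 0 (Nat.zero_le _)
        | succ t => exact h' t (by omega)
      · simp [e0]
    · rintro ⟨z, hz, h, rfl⟩
      refine ⟨(ih _).2 ⟨z, hz, fun t ht => h t (by omega), rfl⟩, by rintro (i | i) <;> simp [hz],
        z 2, hz 2, ?_⟩
      rw [mpMulVec_Abar_max_Bbar]
      exact (ih _).2 ⟨fun t => z (t + 1), fun t => hz _, fun t ht => h (t + 1) (by omega), rfl⟩

theorem mem_mpKsharp_iff (hL : ∀ i j, L i j ≠ ⊤) (hC : ∀ i j, C i j ≠ ⊤)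
    (hR : ∀ i j, R i j ≠ ⊤) (x : Fin n ⊕ Fin n → EReal) :
    x ∈ mpKsharp (Abar n) (Bbar n) (Kset L C R) ↔
      ∃ z : ℕ → Fin n → EReal, (∀ t i, z t i ≠ ⊤) ∧ (∀ t, IsStep L C R (z t) (z (t + 1))) ∧
        x = Sum.elim (z 0) (z 1) := by
  constructor
  · rintro ⟨-, u, -, h⟩
    simp only [mem_Kset_iff hL hC hR] at h
    have e (t : ℕ) (i : Fin n) : mpTraj (Abar n) (Bbar n) x u (t + 1) (Sum.inl i) =
        mpTraj (Abar n) (Bbar n) x u t (Sum.inr i) :=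
      congrFun (mpMulVec_Abar_max_Bbar (mpTraj (Abar n) (Bbar n) x u t) (u t)) (Sum.inl i)
    refine ⟨fun t i => mpTraj (Abar n) (Bbar n) x u t (Sum.inl i), fun t i => (h t).1 _,
      fun t => ?_, ?_⟩
    · simp only [e]
      exact (h t).2
    · funext p
      rcases p with i | i
      · rfl
      · exact (e 0 i).symm
  · rintro ⟨z, hz, h, rfl⟩
    have e (t : ℕ) : mpTraj (Abar n) (Bbar n) (Sum.elim (z 0) (z 1)) (fun t => z (t + 2)) t =
        Sum.elim (z t) (z (t + 1)) := by
      induction t with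
      | zero => rfl
      | succ t ih => rw [mpTraj, ih, mpMulVec_Abar_max_Bbar]; rfl
    have hK (t : ℕ) : Sum.elim (z t) (z (t + 1)) ∈ Kset L C R :=
      (mem_Kset_iff hL hC hR).2 ⟨by rintro (i | i) <;> simp [hz], h t⟩
    exact ⟨hK 0, fun t => z (t + 2), fun t => hz _, fun t => e t ▸ hK t⟩

end Lifted

section RealTrajectories

variable {n : ℕ} {L C R : Fin n → Fin n → EReal}

theorem IsStep.add_const {a b : Fin n → EReal} (h : IsStep L C R a b) (d : EReal) :
    IsStep L C R (fun i => d + a i) (fun i => d + b i) := by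
  intro i j
  obtain ⟨h1, h2, h3, h4⟩ := h i j
  simp only [add_left_comm _ d]
  exact ⟨add_le_add_right h1 d, add_le_add_right h2 d, add_le_add_right h3 d,
    add_le_add_right h4 d⟩

theorem EReal.add_max_le_max {c x y x' y' : EReal} (h : c + x ≤ x') (h' : c + y ≤ y') :
    c + max x y ≤ max x' y' := by
  rcases max_cases x y with ⟨e, -⟩ | ⟨e, -⟩ <;> rw [e]
  exacts [h.trans (le_max_left _ _), h'.trans (le_max_right _ _)]

theorem IsStep.max {a b a' b' : Fin n → EReal} (h : IsStep L C R a b)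
    (h' : IsStep L C R a' b') :
    IsStep L C R (fun i => max (a i) (a' i)) (fun i => max (b i) (b' i)) := fun i j =>
  ⟨EReal.add_max_le_max (h i j).1 (h' i j).1,
    EReal.add_max_le_max (h i j).2.1 (h' i j).2.1,
    EReal.add_max_le_max (h i j).2.2.1 (h' i j).2.2.1,
    EReal.add_max_le_max (h i j).2.2.2 (h' i j).2.2.2⟩

theorem EReal.exists_coe_add_le {x y : EReal} (hx : x ≠ ⊤) (hy : y ≠ ⊥) :
    ∃ c : ℝ, ∀ d : ℝ, d ≤ c → (d : EReal) + x ≤ y := by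
  induction x with
  | bot => exact ⟨0, by simp⟩
  | top => exact absurd rfl hx
  | coe x =>
    induction y with
    | bot => exact absurd rfl hy
    | top => exact ⟨0, by simp⟩
    | coe y => exact ⟨y - x, fun d hd => by norm_cast; linarith⟩

/-- A state that satisfies the constraint given by `C` can be added to the second state of a step,
after a sufficiently negative translation, if the first state is real. -/
theorem IsStep.exists_max_right (hL : ∀ i j, L i j ≠ ⊤) {a b x : Fin n → EReal}
    (ha : ∀ i, a i ≠ ⊥) (hx : ∀ i, x i ≠ ⊤) (hCx : ∀ i j, C i j + x j ≤ x i)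
    (h : IsStep L C R a b) :
    ∃ d : ℝ, IsStep L C R a (fun i => Max.max (b i) (d + x i)) := by
  have key (p : Fin n × Fin n) :
      ∃ c : ℝ, ∀ d : ℝ, d ≤ c → (d : EReal) + (L p.1 p.2 + x p.2) ≤ a p.1 :=
    EReal.exists_coe_add_le (EReal.add_ne_top (hL _ _) (hx _)) (ha _)
  choose c hc using key
  obtain ⟨d, hd⟩ := Finite.exists_ge c
  refine ⟨d, fun i j => ⟨(h i j).1, EReal.add_max_le_max (h i j).2.1 ?_, ?_,
    (h i j).2.2.2.trans (le_max_left _ _)⟩⟩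
  · rw [add_left_comm]
    exact add_le_add_right (hCx i j) _
  · refine (EReal.add_max_le_max (h i j).2.2.1 ?_).trans (max_self _).le
    rw [add_left_comm]
    exact hc (i, j) d (hd _)

/-- One more state of a trajectory is made real, by adding a translate of the delayed
trajectory `x`. -/
theorem exists_trajectory_real_succ (hL : ∀ i j, L i j ≠ ⊤) {P : ℕ → Prop} (hP : Antitone P)
    {x z : ℕ → Fin n → EReal} (hx : ∀ t i, x t i ≠ ⊤)
    (hxs : ∀ t, P t → IsStep L C R (x t) (x (t + 1))) (hx0 : ∀ i, x 0 i ≠ ⊥) (s : ℕ)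
    (hz : ∀ t i, z t i ≠ ⊤) (hzs : ∀ t, P t → IsStep L C R (z t) (z (t + 1)))
    (hzr : ∀ t ≤ s, ∀ i, z t i ≠ ⊥) :
    ∃ w : ℕ → Fin n → EReal, (∀ t i, w t i ≠ ⊤) ∧
      (∀ t, P t → IsStep L C R (w t) (w (t + 1))) ∧ (∀ t ≤ s + 1, ∀ i, w t i ≠ ⊥) ∧
      ∀ t ≤ s, w t = z t := by
  obtain ⟨d, hd⟩ : ∃ d : ℝ, P s →
      IsStep L C R (z s) (fun i => max (z (s + 1) i) (d + x 0 i)) := by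
    by_cases hs : P s
    · obtain ⟨d, hd⟩ := (hzs s hs).exists_max_right hL (hzr s le_rfl) (hx 0)
        fun i j => (hxs 0 (hP (Nat.zero_le s) hs) i j).1
      exact ⟨d, fun _ => hd⟩
    · exact ⟨0, fun h => absurd h hs⟩
  let w : ℕ → Fin n → EReal := fun t =>
    if t ≤ s then z t else fun i => max (z t i) (d + x (t - (s + 1)) i)
  have hle {t : ℕ} (ht : t ≤ s) : w t = z t := if_pos ht
  have hgt (r : ℕ) : w (s + 1 + r) = fun i => max (z (s + 1 + r) i) (d + x r i) := by
    simp only [w]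
    rw [if_neg (by omega), Nat.add_sub_cancel_left]
  refine ⟨w, fun t i => ?_, fun t ht => ?_, fun t ht i => ?_, fun t ht => hle ht⟩
  · rcases le_or_gt t s with h | h
    · rw [hle h]
      exact hz t i
    · obtain ⟨r, rfl⟩ := Nat.exists_eq_add_of_le (Nat.succ_le_of_lt h)
      simp only [hgt]
      rcases max_choice (z (s + 1 + r) i) (d + x r i) with e | e <;> rw [e]
      exacts [hz _ _, EReal.add_ne_top (EReal.coe_ne_top d) (hx _ _)]
  · rcases lt_trichotomy t s with h | rfl | h
    · rw [hle h.le, hle h]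
      exact hzs t ht
    · have e := hgt 0
      rw [add_zero] at e
      rw [hle le_rfl, e]
      exact hd ht
    · obtain ⟨r, rfl⟩ := Nat.exists_eq_add_of_le (Nat.succ_le_of_lt h)
      rw [show s.succ + r + 1 = s + 1 + (r + 1) by omega, hgt, hgt]
      exact (hzs _ ht).max ((hxs r (hP (by omega) ht)).add_const d)
  · rcases Nat.lt_or_eq_of_le ht with h | rfl
    · rw [hle (by omega)]
      exact hzr t (by omega) i
    · have e := hgt 0
      rw [add_zero] at e
      rw [e]
      refine ne_bot_of_le_ne_bot ?_ (le_max_right _ _)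
      exact fun h => (EReal.add_eq_bot_iff.1 h).elim (EReal.coe_ne_bot d) (hx0 i)

/-- A trajectory in `ℝ_max^n` whose first two states are real can be replaced by a real trajectory
with the same first two states. -/
theorem exists_real_trajectory (hL : ∀ i j, L i j ≠ ⊤) {P : ℕ → Prop} (hP : Antitone P)
    {x : ℕ → Fin n → EReal} (hx : ∀ t i, x t i ≠ ⊤)
    (hxs : ∀ t, P t → IsStep L C R (x t) (x (t + 1))) (hx0 : ∀ i, x 0 i ≠ ⊥)
    (hx1 : ∀ i, x 1 i ≠ ⊥) :
    ∃ y : ℕ → Fin n → ℝ, (∀ i, (y 0 i : EReal) = x 0 i) ∧ (∀ i, (y 1 i : EReal) = x 1 i) ∧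
      ∀ t, P t → IsStep L C R (fun i => y t i) (fun i => y (t + 1) i) := by
  let Good (s : ℕ) (z : ℕ → Fin n → EReal) : Prop :=
    (∀ t i, z t i ≠ ⊤) ∧ (∀ t, P t → IsStep L C R (z t) (z (t + 1))) ∧
      ∀ t ≤ s + 1, ∀ i, z t i ≠ ⊥
  have good_zero : Good 0 x := ⟨hx, hxs, fun t ht i => by
    obtain rfl | rfl : t = 0 ∨ t = 1 := by omega
    exacts [hx0 i, hx1 i]⟩
  have good_succ (s : ℕ) (z : {z // Good s z}) :
      ∃ w : {w // Good (s + 1) w}, ∀ t ≤ s + 1, w.1 t = z.1 t := by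
    obtain ⟨z, hz, hzs, hzr⟩ := z
    obtain ⟨w, h1, h2, h3, h4⟩ := exists_trajectory_real_succ hL hP hx hxs hx0 (s + 1) hz hzs hzr
    exact ⟨⟨w, h1, h2, h3⟩, h4⟩
  choose next hnext using good_succ
  let F : ∀ s, {z // Good s z} := fun s => Nat.rec ⟨x, good_zero⟩ next s
  have hF (s : ℕ) : ∀ t ≤ s + 1, (F (s + 1)).1 t = (F s).1 t := hnext s (F s)
  have coe_toReal (t : ℕ) (i : Fin n) : (((F t).1 t i).toReal : EReal) = (F t).1 t i :=
    EReal.coe_toReal ((F t).2.1 t i) ((F t).2.2.2 t (by omega) i)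
  refine ⟨fun t i => ((F t).1 t i).toReal, fun i => coe_toReal 0 i, fun i => ?_, fun t ht => ?_⟩
  · rw [coe_toReal]
    exact congrFun (hF 0 1 le_rfl) i
  · simp only [coe_toReal]
    rw [← hF t t (by omega)]
    exact (F (t + 1)).2.2.1 t ht

theorem isStep_coe_iff {a b : Fin n → ℝ} :
    IsStep L C R (fun i => a i) (fun i => b i) ↔
      ∀ i, mpMulVec C (fun j => (a j : EReal)) i ≤ a i ∧
        mpMulVec C (fun j => (b j : EReal)) i ≤ b i ∧
        mpMulVec L (fun j => (b j : EReal)) i ≤ a i ∧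
        mpMulVec R (fun j => (a j : EReal)) i ≤ b i := by
  simp only [IsStep, mpMulVec, iSup_le_iff, forall_and]

theorem consistent_iff :
    Consistent L C R ↔
      ∃ y : ℕ → Fin n → ℝ, ∀ t, IsStep L C R (fun i => y t i) (fun i => y (t + 1) i) := by
  simp only [isStep_coe_iff]
  refine exists_congr fun y => ⟨fun h t i => ?_, fun h t => ?_⟩
  · exact ⟨(h t).2.1 i, (h (t + 1)).2.1 i, (h t).1 i, (h t).2.2 i⟩
  · exact ⟨fun i => (h t i).2.2.1, fun i => (h t i).1, fun i => (h t i).2.2.2⟩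

theorem weaklyConsistent_iff :
    WeaklyConsistent L C R ↔ ∀ k : ℕ,
      ∃ y : ℕ → Fin n → ℝ, ∀ t ≤ k, IsStep L C R (fun i => y t i) (fun i => y (t + 1) i) := by
  simp only [isStep_coe_iff]
  constructor
  · intro h k
    obtain ⟨x, hx, hx'⟩ := h (k + 2)
    refine ⟨fun t => if ht : t < k + 2 then x ⟨t, ht⟩ else 0, fun t ht i => ?_⟩
    have h1 : t < k + 2 := by omega
    have h2 : t + 1 < k + 2 := by omega
    simp only [h1, h2, dif_pos]
    exact ⟨hx _ i, hx _ i, hx' ⟨t, h1⟩ h2 i⟩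
  · intro h K
    obtain ⟨y, hy⟩ := h K
    exact ⟨fun t => y t, fun t i => (hy t t.2.le i).1,
      fun t _ i => (hy t t.2.le i).2.2⟩

/-- The real part of `φ^k(K)` consists of the first two states of real trajectories. -/
theorem mem_iterate_mpPhi_inter_RealVecs_iff (hL : ∀ i j, L i j ≠ ⊤) (hC : ∀ i j, C i j ≠ ⊤)
    (hR : ∀ i j, R i j ≠ ⊤) (k : ℕ) (x : Fin n ⊕ Fin n → EReal) :
    x ∈ (mpPhi (Abar n) (Bbar n))^[k] (Kset L C R) ∩ RealVecs ↔
      ∃ y : ℕ → Fin n → ℝ, (∀ t ≤ k, IsStep L C R (fun i => y t i) (fun i => y (t + 1) i)) ∧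
        x = Sum.elim (fun i => (y 0 i : EReal)) (fun i => (y 1 i : EReal)) := by
  rw [Set.mem_inter_iff, mem_iterate_mpPhi_iff hL hC hR]
  constructor
  · rintro ⟨⟨z, hz, h, rfl⟩, hr⟩
    obtain ⟨y, h0, h1, hy⟩ := exists_real_trajectory hL (P := (· ≤ k))
      (fun _ _ hab hb => hab.trans hb) hz h (fun i => (hr (Sum.inl i)).2)
      (fun i => (hr (Sum.inr i)).2)
    exact ⟨y, hy, by simp only [h0, h1]⟩
  · rintro ⟨y, hy, rfl⟩
    exact ⟨⟨fun t i => y t i, by simp, hy, rfl⟩, by rintro (i | i) <;> simp⟩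

theorem mpKsharp_inter_RealVecs_nonempty_iff (hL : ∀ i j, L i j ≠ ⊤) (hC : ∀ i j, C i j ≠ ⊤)
    (hR : ∀ i j, R i j ≠ ⊤) :
    (mpKsharp (Abar n) (Bbar n) (Kset L C R) ∩ RealVecs).Nonempty ↔ Consistent L C R := by
  rw [consistent_iff]
  constructor
  · rintro ⟨x, hx, hr⟩
    obtain ⟨z, hz, h, rfl⟩ := (mem_mpKsharp_iff hL hC hR x).1 hx
    obtain ⟨y, -, -, hy⟩ := exists_real_trajectory hL (P := fun _ => True)
      (fun _ _ _ => id) hz (fun t _ => h t) (fun i => (hr (Sum.inl i)).2)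
      (fun i => (hr (Sum.inr i)).2)
    exact ⟨y, fun t => hy t trivial⟩
  · rintro ⟨y, hy⟩
    exact ⟨_, (mem_mpKsharp_iff hL hC hR _).2 ⟨fun t i => y t i, by simp, hy, rfl⟩,
      by rintro (i | i) <;> simp⟩

theorem weaklyConsistent_iff_nonempty (hL : ∀ i j, L i j ≠ ⊤) (hC : ∀ i j, C i j ≠ ⊤)
    (hR : ∀ i j, R i j ≠ ⊤) :
    WeaklyConsistent L C R ↔
      ∀ k : ℕ, ((mpPhi (Abar n) (Bbar n))^[k] (Kset L C R) ∩ RealVecs).Nonempty := by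
  rw [weaklyConsistent_iff]
  refine forall_congr' fun k => ⟨?_, ?_⟩
  · rintro ⟨y, hy⟩
    exact ⟨_, (mem_iterate_mpPhi_inter_RealVecs_iff hL hC hR k _).2 ⟨y, hy, rfl⟩⟩
  · rintro ⟨x, hx⟩
    obtain ⟨y, hy, -⟩ := (mem_iterate_mpPhi_inter_RealVecs_iff hL hC hR k x).1 hx
    exact ⟨y, hy⟩

/-- If the real part of `φ^k(K)` is nonempty and stabilizes, then system (8) is consistent. -/
theorem consistent_of_iterate_mpPhi_stable (hL : ∀ i j, L i j ≠ ⊤) (hC : ∀ i j, C i j ≠ ⊤)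
    (hR : ∀ i j, R i j ≠ ⊤) {k : ℕ}
    (hne : ((mpPhi (Abar n) (Bbar n))^[k] (Kset L C R) ∩ RealVecs).Nonempty)
    (heq : (mpPhi (Abar n) (Bbar n))^[k + 1] (Kset L C R) ∩ RealVecs =
      (mpPhi (Abar n) (Bbar n))^[k] (Kset L C R) ∩ RealVecs) : Consistent L C R := by
  let Y := {y : ℕ → Fin n → ℝ // ∀ t ≤ k, IsStep L C R (fun i => y t i) (fun i => y (t + 1) i)}
  obtain ⟨x, hx⟩ := hne
  obtain ⟨y₀, hy₀, -⟩ := (mem_iterate_mpPhi_inter_RealVecs_iff hL hC hR k x).1 hx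
  have step (y : Y) : ∃ y' : Y, y'.1 0 = y.1 1 := by
    have hy := (mem_iterate_mpPhi_inter_RealVecs_iff hL hC hR k _).2 ⟨y.1, y.2, rfl⟩
    rw [← heq] at hy
    obtain ⟨w, hw, e⟩ := (mem_iterate_mpPhi_inter_RealVecs_iff hL hC hR (k + 1) _).1 hy
    refine ⟨⟨fun t => w (t + 1), fun t ht => hw (t + 1) (by omega)⟩, funext fun i => ?_⟩
    exact (EReal.coe_injective (congrFun e (Sum.inr i))).symm
  choose next hnext using step
  refine consistent_iff.2 ⟨fun t => (next^[t] ⟨y₀, hy₀⟩).1 0, fun t => ?_⟩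
  simp only [Function.iterate_succ_apply', hnext]
  exact (next^[t] ⟨y₀, hy₀⟩).2 0 (Nat.zero_le k)

end RealTrajectories

/-- `φ^k(K) ∩ ℝ^{2n}` never stabilizes and
`K^♯ ∩ ℝ^{2n} = ∅` iff system (8) is weakly consistent but not consistent. -/
theorem stmt_18 (n : ℕ) (hn : 0 < n) (L C R : Fin n → Fin n → EReal)
    (hL : ∀ i j, L i j ≠ ⊤) (hC : ∀ i j, C i j ≠ ⊤) (hR : ∀ i j, R i j ≠ ⊤) :
    ((∀ k : ℕ,
        (mpPhi (Abar n) (Bbar n))^[k + 1] (Kset L C R) ∩ RealVecs ≠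
          (mpPhi (Abar n) (Bbar n))^[k] (Kset L C R) ∩ RealVecs) ∧
      mpKsharp (Abar n) (Bbar n) (Kset L C R) ∩ RealVecs = ∅) ↔
    (WeaklyConsistent L C R ∧ ¬ Consistent L C R) := by
  rw [← Set.not_nonempty_iff_eq_empty, mpKsharp_inter_RealVecs_nonempty_iff hL hC hR]
  refine and_congr_left fun hcons => ?_
  rw [weaklyConsistent_iff_nonempty hL hC hR]
  refine ⟨fun h k => ?_, fun h k heq =>
    hcons (consistent_of_iterate_mpPhi_stable hL hC hR (h k) heq)⟩
  by_contra hne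
  rw [Set.not_nonempty_iff_eq_empty] at hne
  refine h k (hne.symm ▸ Set.subset_empty_iff.1 (hne ▸ Set.inter_subset_inter_left _ ?_))
  rw [Function.iterate_succ_apply']
  exact Set.inter_subset_left
end
end
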